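/- arXiv:2011.07621 — 2 statements merged into one kernel-verified Lean document; each statement's English description precedes it below -/
import Mathlib

section
/- Let G be a digraph. The graph algebra A(G) satisfies some nontrivial bracketing identity (i.e., G is not antiassociative) if and only if all of the following hold: (i) every nontrivial strongly connected component of G is a whirl; (ii) there is no path from one nontrivial strongly connected component of G to another; (iii) there is a finite upper bound on the lengths of the pleasant paths in G; (iv) there is a finite upper bound on the numbers m such that G contains an m-whirl as a strongly connected component. -/
namespace AssocSpec

/-- Bracketings of products `x₁ x₂ ⋯ xₙ` represented as binary trees whose
leaves, read from left to right, are the variables `x₁, …, xₙ`. -/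
inductive BTree : Type
  | leaf : BTree
  | node : BTree → BTree → BTree

namespace BTree

/-- The size of a bracketing: its number of variables (leaves). -/
def size : BTree → ℕ
  | leaf => 1
  | node l r => l.size + r.size

/-- Evaluate a bracketing in a magma `(A, op)`, the leaves taking the values
`f k, f (k+1), …` from left to right. -/
def evalFrom {A : Type*} (op : A → A → A) : BTree → (ℕ → A) → ℕ → A
  | leaf, f, k => f k
  | node l r, f, k => op (evalFrom op l f k) (evalFrom op r f (k + l.size))

/-- The term operation induced by a bracketing `t` on a magma `(A, op)`;
the `i`-th variable (0-indexed) takes the value `f i`. -/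
def termOp {A : Type*} (op : A → A → A) (t : BTree) (f : ℕ → A) : A :=
  evalFrom op t f 0

/-- The depth sequence of the DFS tree `G(t)` of a bracketing `t`: the `i`-th
entry is the depth of the `i`-th variable (0-indexed) in `G(t)`. -/
def depths : BTree → List ℕ
  | leaf => [0]
  | node l r => l.depths ++ r.depths.map (· + 1)

/-- The depth of the `i`-th variable (0-indexed) in the DFS tree `G(t)`. -/
def depth (t : BTree) (i : ℕ) : ℕ := t.depths.getD i 0

/-- The height of the DFS tree `G(t)`: the maximum depth of a variable. -/
def height (t : BTree) : ℕ := t.depths.foldr max 0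

/-- The edges of the DFS tree `G(t)`, the variables being indexed from the
given offset: `(p, c)` is an edge iff `x_p` is the parent of `x_c`. -/
def edgesFrom : BTree → ℕ → List (ℕ × ℕ)
  | leaf, _ => []
  | node l r, k => (k, k + l.size) :: (l.edgesFrom k ++ r.edgesFrom (k + l.size))

/-- The edges of the DFS tree `G(t)` (variables indexed from `0`). -/
def edges (t : BTree) : List (ℕ × ℕ) := t.edgesFrom 0

end BTree

open Classical in
/-- The operation of the graph algebra of the digraph with vertex set `V` and
edge relation `E`; `none` plays the role of `∞`. -/
noncomputable def gaOp {V : Type*} (E : V → V → Prop) :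
    Option V → Option V → Option V
  | some x, some y => if E x y then some x else none
  | _, _ => none

/-- The magma `(A, op)` satisfies the bracketing identity `t ≈ t'`. -/
def Satisfies {A : Type*} (op : A → A → A) (t t' : BTree) : Prop :=
  ∀ f : ℕ → A, BTree.termOp op t f = BTree.termOp op t' f

/-- The `n`-th member `s_n` of the associative spectrum of the magma `(A, op)`:
the number of distinct term operations induced by bracketings of size `n`. -/
noncomputable def spectrum {A : Type*} (op : A → A → A) (n : ℕ) : ℕ :=
  Set.ncard {g : (ℕ → A) → A | ∃ t : BTree, t.size = n ∧ g = BTree.termOp op t}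

/-- Reachability (by a walk) in the digraph with edge relation `E`. -/
def Reach {V : Type*} (E : V → V → Prop) : V → V → Prop :=
  Relation.ReflTransGen E

/-- `u` and `v` lie in the same strongly connected component. -/
def SameSCC {V : Type*} (E : V → V → Prop) (u v : V) : Prop :=
  Reach E u v ∧ Reach E v u

/-- The strongly connected component of `v`, as a set of vertices. -/
def scc {V : Type*} (E : V → V → Prop) (v : V) : Set V :=
  {u | SameSCC E u v}

/-- `v` lies in a nontrivial strongly connected component (one carrying at
least one edge), i.e. `v` lies on a closed walk of positive length. -/
def InNontrivialSCC {V : Type*} (E : V → V → Prop) (v : V) : Prop :=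
  ∃ u, E v u ∧ Reach E u v

/-- The induced subgraph on the set `K` (with the edge relation `E`) is an
`m`-whirl: `K` is partitioned into blocks `B 0, …, B (m-1)` so that edges go
exactly from each block to the cyclically next one. -/
def IsWhirlOn {V : Type*} (E : V → V → Prop) (K : Set V) (m : ℕ) : Prop :=
  ∃ B : ZMod m → Set V,
    (∀ i, (B i).Nonempty) ∧
    (∀ i, B i ⊆ K) ∧
    (∀ x ∈ K, ∃! i, x ∈ B i) ∧
    (∀ x ∈ K, ∀ y ∈ K, (E x y ↔ ∃ i, x ∈ B i ∧ y ∈ B (i + 1)))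

/-- `p 0 → p 1 → ⋯ → p len` is a path (a walk with pairwise distinct
vertices) in the digraph with edge relation `E`. -/
def IsPath {V : Type*} (E : V → V → Prop) (len : ℕ) (p : ℕ → V) : Prop :=
  (∀ i < len, E (p i) (p (i + 1))) ∧
  (∀ i ≤ len, ∀ j ≤ len, p i = p j → i = j)

/-- The walk `p 0 → ⋯ → p len` is pleasant: all its vertices belong to
trivial strongly connected components. -/
def IsPleasant {V : Type*} (E : V → V → Prop) (len : ℕ) (p : ℕ → V) : Prop :=
  ∀ i ≤ len, ¬ InNontrivialSCC E (p i)

/-- The connected component `K` (of an undirected graph) is complete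
bipartite: it splits into two nonempty parts with edges exactly between
vertices of different parts. -/
def IsCompleteBipartiteOn {V : Type*} (E : V → V → Prop) (K : Set V) : Prop :=
  ∃ B1 B2 : Set V, B1.Nonempty ∧ B2.Nonempty ∧ B1 ∪ B2 = K ∧ B1 ∩ B2 = ∅ ∧
    ∀ x ∈ K, ∀ y ∈ K, (E x y ↔ (x ∈ B1 ∧ y ∈ B2) ∨ (x ∈ B2 ∧ y ∈ B1))

/-- A DFS tree of size `n`: a rooted directed tree on the vertices
`x₁, …, xₙ` (here `Fin n`, the root being `0`), given by its parent function,
such that the parent of every non-root vertex precedes it and the vertex set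
of the induced subtree rooted at any vertex `i` is an interval `[i, i']`.
(The parent of the root is, by convention, the root itself.) -/
structure DFSTree (n : ℕ) where
  parent : Fin n → Fin n
  parent_lt : ∀ i : Fin n, 0 < (i : ℕ) → (parent i : ℕ) < (i : ℕ)
  parent_root : ∀ i : Fin n, (i : ℕ) = 0 → parent i = i
  interval : ∀ i j k : Fin n, i ≤ j → j ≤ k →
    (∃ a : ℕ, parent^[a] k = i) → (∃ a : ℕ, parent^[a] j = i)

/-- The depth of the vertex `i` in a DFS tree: the length of the path from
the root to `i`. -/
noncomputable def DFSTree.depth {n : ℕ} (T : DFSTree n) (i : Fin n) : ℕ :=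
  sInf {k : ℕ | (T.parent^[k] i : ℕ) = 0}

/-- The height of a DFS tree: the maximum depth of a vertex. -/
noncomputable def DFSTree.height {n : ℕ} (T : DFSTree n) : ℕ :=
  Finset.univ.sup fun i => T.depth i

/-- The vertex `i` is a leaf (childless vertex) of the DFS tree `T`. -/
def DFSTree.IsLeaf {n : ℕ} (T : DFSTree n) (i : Fin n) : Prop :=
  ∀ j : Fin n, T.parent j = i → j = i

/-- `t_h(n)`: the number of DFS trees of size `n` of height at most `h`. -/
noncomputable def tcount (h n : ℕ) : ℕ :=
  Nat.card {T : DFSTree n // T.height ≤ h}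

/-- `d` is a zag sequence: `d₁ = 0`, `d₂ = 1`, and
`1 ≤ d_{i+1} ≤ d_i + 1` for all `i` (1-indexed as in the paper;
here `d : Fin n → ℕ` is 0-indexed). -/
def IsZag {n : ℕ} (d : Fin n → ℕ) : Prop :=
  (∀ h : 0 < n, d ⟨0, h⟩ = 0) ∧
  (∀ h : 1 < n, d ⟨1, h⟩ = 1) ∧
  (∀ i : ℕ, ∀ h : i + 1 < n,
    1 ≤ d ⟨i + 1, h⟩ ∧ d ⟨i + 1, h⟩ ≤ d ⟨i, Nat.lt_of_succ_lt h⟩ + 1)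

/-- `M(t,t')`: the largest `m` such that the depth sequences of the DFS trees
of the bracketings `t` and `t'` are congruent modulo `m`. -/
noncomputable def Mval (t t' : BTree) : ℕ :=
  sSup {m : ℕ | ∀ i < t.size, t.depth i ≡ t'.depth i [MOD m]}

end AssocSpec

namespace AssocSpec

section Helpers

variable {V : Type*} (E : V → V → Prop)

/-- Homomorphisms from the DFS tree of a bracketing. -/
def Hm : BTree → (ℕ → V) → Prop
  | .leaf, _ => True
  | .node l r, f => Hm l f ∧ Hm r (fun j => f (j + l.size)) ∧ E (f 0) (f l.size)

theorem size_pos : ∀ t : BTree, 0 < t.size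
  | .leaf => by simp [BTree.size]
  | .node l r => by have := size_pos l; simp [BTree.size]; omega

open Classical in
theorem eval_some (t : BTree) (F : ℕ → Option V) (k : ℕ) (f : ℕ → V)
    (h : ∀ j < t.size, F (k + j) = some (f j)) :
    BTree.evalFrom (gaOp E) t F k = if Hm E t f then some (f 0) else none := by
  induction t generalizing k f with
  | leaf => simpa [BTree.evalFrom, Hm] using h 0 (by simp [BTree.size])
  | node l r ihl ihr =>
    simp only [BTree.size] at h
    simp only [BTree.evalFrom, Hm]
    rw [ihl k f (fun j hj => h j (by omega)),
      ihr (k + l.size) (fun j => f (j + l.size)) (fun j hj => by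
        have := h (j + l.size) (by omega)
        rw [← this]; congr 1; omega)]
    by_cases h1 : Hm E l f <;> by_cases h2 : Hm E r (fun j => f (j + l.size)) <;>
      simp [h1, h2, gaOp]

theorem eval_none (t : BTree) (F : ℕ → Option V) (k : ℕ)
    (h : ∃ j < t.size, F (k + j) = none) :
    BTree.evalFrom (gaOp E) t F k = none := by
  induction t generalizing k with
  | leaf =>
    obtain ⟨j, hj, h⟩ := h
    simp only [BTree.size] at hj
    obtain rfl : j = 0 := by omega
    simpa [BTree.evalFrom] using h
  | node l r ihl ihr =>
    obtain ⟨j, hj, h⟩ := h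
    simp only [BTree.size] at hj
    simp only [BTree.evalFrom]
    by_cases hl : j < l.size
    · rw [ihl k ⟨j, hl, h⟩]; simp [gaOp]
    · rw [ihr (k + l.size) ⟨j - l.size, by omega, by rw [← h]; congr 1; omega⟩]
      cases BTree.evalFrom (gaOp E) l F k <;> simp [gaOp]

theorem satisfies_iff [Nonempty V] (t t' : BTree) (hs : t.size = t'.size) :
    Satisfies (gaOp E) t t' ↔ ∀ f : ℕ → V, Hm E t f ↔ Hm E t' f := by
  classical
  constructor
  · intro h f
    have := h (fun j => some (f j))
    simp only [BTree.termOp] at this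
    rw [eval_some E t _ 0 f (by simp), eval_some E t' _ 0 f (by simp)] at this
    by_cases h1 : Hm E t f <;> by_cases h2 : Hm E t' f <;> simp_all
  · intro h F
    simp only [BTree.termOp]
    by_cases hn : ∃ j < t.size, F (0 + j) = none
    · rw [eval_none E t F 0 hn, eval_none E t' F 0 (hs ▸ hn)]
    · push Not at hn
      let f : ℕ → V := fun j => (F j).getD (Classical.arbitrary V)
      have hf : ∀ j < t.size, F (0 + j) = some (f j) := by
        intro j hj
        have := hn j hj
        simp only [zero_add] at this ⊢
        obtain ⟨x, hx⟩ := Option.ne_none_iff_exists'.1 this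
        simp [f, hx]
      rw [eval_some E t F 0 f hf, eval_some E t' F 0 f (hs ▸ hf)]
      simp [h f]

theorem Hm_congr (t : BTree) (f g : ℕ → V) (h : ∀ j < t.size, f j = g j) :
    Hm E t f → Hm E t g := by
  induction t generalizing f g with
  | leaf => simp [Hm]
  | node l r ihl ihr =>
    simp only [BTree.size] at h
    have hl := size_pos l
    have hr := size_pos r
    rintro ⟨h1, h2, h3⟩
    refine ⟨ihl f g (fun j hj => h j (by omega)) h1,
      ihr _ _ (fun j hj => h _ (by omega)) h2, ?_⟩
    rw [← h 0 (by omega), ← h l.size (by omega)]; exact h3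

/-- Depth function. -/
def Dp : BTree → ℕ → ℕ
  | .leaf, _ => 0
  | .node l r, j => if j < l.size then Dp l j else Dp r (j - l.size) + 1

theorem Dp_zero (t : BTree) : Dp t 0 = 0 := by
  induction t with
  | leaf => rfl
  | node l r ihl ihr => simp [Dp, size_pos l, ihl]

theorem Dp_pos (t : BTree) (j : ℕ) (h : 0 < j) (h' : j < t.size) : 0 < Dp t j := by
  induction t with
  | leaf => simp [BTree.size] at h'; omega
  | node l r ihl ihr =>
    simp only [Dp]
    split_ifs with hl
    · exact ihl hl
    · omega

theorem Hm_walk (t : BTree) (a : ℕ → V) (h : ∀ j < t.size, E (a j) (a (j+1))) :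
    Hm E t (fun j => a (Dp t j)) := by
  induction t generalizing a with
  | leaf => simp [Hm]
  | node l r ihl ihr =>
    simp only [BTree.size] at h
    have hl := size_pos l
    have hr := size_pos r
    refine ⟨Hm_congr E l _ _ ?_ (ihl a (fun j hj => h j (by omega))),
      Hm_congr E r _ _ ?_ (ihr (fun j => a (j+1)) (fun j hj => h _ (by omega))), ?_⟩
    · intro j hj; simp [Dp, hj]
    · intro j hj; simp [Dp]
    · simp only [Dp, hl, if_true, Dp_zero, lt_irrefl, if_false, Nat.sub_self]
      exact h 0 (by omega)

/-- Glueing homomorphisms. -/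
theorem Hm_glue (l r : BTree) (f g : ℕ → V) (hf : Hm E l f) (hg : Hm E r g)
    (h : E (f 0) (g 0)) :
    Hm E (.node l r) (fun j => if j < l.size then f j else g (j - l.size)) := by
  refine ⟨Hm_congr E l _ _ ?_ hf, Hm_congr E r _ _ ?_ hg, ?_⟩
  · intro j hj; simp [hj]
  · intro j hj; simp
  · simpa [size_pos l] using h

theorem exists_parent (t : BTree) (i : ℕ) (h0 : 0 < i) (hi : i < t.size) :
    ∃ q < i, ∀ f : ℕ → V, Hm E t f → E (f q) (f i) := by
  induction t generalizing i with
  | leaf => simp [BTree.size] at hi; omega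
  | node l r ihl ihr =>
    simp only [BTree.size] at hi
    rcases lt_trichotomy i l.size with h | h | h
    · obtain ⟨q, hq, H⟩ := ihl i h0 h
      exact ⟨q, hq, fun f hf => H f hf.1⟩
    · exact ⟨0, h0, fun f hf => h ▸ hf.2.2⟩
    · obtain ⟨q, hq, H⟩ := ihr (i - l.size) (by omega) (by omega)
      refine ⟨q + l.size, by omega, fun f hf => ?_⟩
      have := H _ hf.2.1
      simpa [Nat.sub_add_cancel h.le] using this

/-- Separation. -/
def Sep (t t' : BTree) : Prop :=
  ∃ s e N : ℕ, ∀ a b : ℕ → V, (∀ j < N, E (a j) (a (j+1))) → (∀ j < N, E (b j) (b (j+1))) →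
    E (a s) (b 0) → ∃ f : ℕ → V, f 0 = a 0 ∧ Hm E t f ∧ (Hm E t' f → E (a (s+1+e)) (b 0))

theorem Sep_left (l r l' r' : BTree) (hs : l.size = l'.size) (h : Sep E l l') :
    Sep E (.node l r) (.node l' r') := by
  obtain ⟨s, e, N, h⟩ := h
  refine ⟨s, e, N + r.size + 1, fun a b ha hb hab => ?_⟩
  obtain ⟨f, f0, hf, hf'⟩ := h a b (fun j hj => ha j (by omega)) (fun j hj => hb j (by omega)) hab
  refine ⟨fun j => if j < l.size then f j else a (Dp r (j - l.size) + 1), ?_, ?_, ?_⟩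
  · simp [size_pos l, f0]
  · refine Hm_glue E l r f (fun j => a (Dp r j + 1)) hf
      (Hm_walk E r (fun j => a (j+1)) fun j hj => ha _ (by omega)) ?_
    simp only [f0, Dp_zero]; exact ha 0 (by omega)
  · rintro ⟨h1, -, -⟩
    refine hf' (Hm_congr E l' _ _ ?_ h1)
    intro j hj; simp [hs, hj]

theorem Sep_right (l r l' r' : BTree) (hs : l.size = l'.size) (h : Sep E r r') :
    Sep E (.node l r) (.node l' r') := by
  obtain ⟨s, e, N, h⟩ := h
  refine ⟨s + 1, e, N + l.size + 1, fun a b ha hb hab => ?_⟩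
  obtain ⟨f, f0, hf, hf'⟩ := h (fun j => a (j+1)) b (fun j hj => ha _ (by omega))
    (fun j hj => hb j (by omega)) hab
  refine ⟨fun j => if j < l.size then a (Dp l j) else f (j - l.size), ?_, ?_, ?_⟩
  · simp [size_pos l, Dp_zero]
  · refine Hm_glue E l r (fun j => a (Dp l j)) f
      (Hm_walk E l a fun j hj => ha _ (by omega)) hf ?_
    simp only [f0, Dp_zero]; exact ha 0 (by omega)
  · rintro ⟨-, h2, -⟩
    have := hf' (Hm_congr E r' _ _ ?_ h2)
    · convert this using 2; omega
    · intro j hj; simp [hs]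

theorem Sep_base (l r l' r' : BTree) (hs : l.size + r.size = l'.size + r'.size)
    (hlt : l.size < l'.size) : Sep E (.node l' r') (.node l r) := by
  have hl := size_pos l
  have hr' := size_pos r'
  obtain ⟨q, hq, H⟩ := exists_parent E r (l'.size - l.size) (by omega) (by omega)
  have hp := Dp_pos l' (q + l.size) (by omega) (by omega)
  refine ⟨0, Dp l' (q + l.size) - 1, l'.size + r'.size, fun a b ha hb hab => ?_⟩
  refine ⟨fun j => if j < l'.size then a (Dp l' j) else b (Dp r' (j - l'.size)), ?_, ?_, ?_⟩
  · simp [size_pos l', Dp_zero]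
  · refine Hm_glue E l' r' (fun j => a (Dp l' j)) (fun j => b (Dp r' j))
      (Hm_walk E l' a fun j hj => ha _ (by omega))
      (Hm_walk E r' b fun j hj => hb _ (by omega)) ?_
    simpa only [Dp_zero] using hab
  · rintro ⟨-, h2, -⟩
    have := H _ h2
    simp only [Nat.sub_add_cancel hlt.le, lt_irrefl, if_false, Nat.sub_self, Dp_zero] at this
    rw [if_pos (by omega)] at this
    convert this using 2; omega

theorem Sep_total (t t' : BTree) (hs : t.size = t'.size) (hne : t ≠ t') :
    Sep E t t' ∨ Sep E t' t := by
  induction t generalizing t' with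
  | leaf =>
    cases t' with
    | leaf => exact absurd rfl hne
    | node l r => have := size_pos l; have := size_pos r; simp [BTree.size] at hs; omega
  | node l r ihl ihr =>
    cases t' with
    | leaf => have := size_pos l; have := size_pos r; simp [BTree.size] at hs; omega
    | node l' r' =>
      simp only [BTree.size] at hs
      rcases lt_trichotomy l.size l'.size with h | h | h
      · exact Or.inr (Sep_base E l r l' r' hs h)
      · by_cases hl : l = l'
        · have hr : r ≠ r' := by rintro rfl; exact hne (by rw [hl])
          exact (ihr r' (by omega) hr).imp (Sep_right E _ _ _ _ h) (Sep_right E _ _ _ _ h.symm)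
        · exact (ihl l' h hl).imp (Sep_left E _ _ _ _ h) (Sep_left E _ _ _ _ h.symm)
      · exact Or.inl (Sep_base E l' r' l r hs.symm h)

/-- Walks of given length. -/
def Wk : ℕ → V → V → Prop
  | 0, x, y => x = y
  | k+1, x, y => ∃ z, E x z ∧ Wk k z y

theorem Wk_trans {k l : ℕ} {x y z : V} (h : Wk E k x y) (h' : Wk E l y z) :
    Wk E (k + l) x z := by
  induction k generalizing x with
  | zero => cases h; simpa using h'
  | succ k ih =>
    obtain ⟨c, hc, h⟩ := h
    rw [Nat.add_right_comm]
    exact ⟨c, hc, ih h⟩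

theorem Wk_split {k l : ℕ} {x z : V} (h : Wk E (k + l) x z) :
    ∃ y, Wk E k x y ∧ Wk E l y z := by
  induction k generalizing x with
  | zero => exact ⟨x, rfl, by simpa using h⟩
  | succ k ih =>
    rw [Nat.add_right_comm] at h
    obtain ⟨c, hc, h⟩ := h
    obtain ⟨y, h1, h2⟩ := ih h
    exact ⟨y, ⟨c, hc, h1⟩, h2⟩

theorem Wk_one {x y : V} (h : E x y) : Wk E 1 x y := ⟨y, h, rfl⟩

theorem Wk_snoc {k : ℕ} {x y z : V} (h : Wk E k x y) (h' : E y z) : Wk E (k+1) x z :=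
  Wk_trans E h (Wk_one E h')

theorem Wk_unsnoc {k : ℕ} {x z : V} (h : Wk E (k+1) x z) : ∃ y, Wk E k x y ∧ E y z := by
  obtain ⟨y, h1, c, h2, h3⟩ := Wk_split E h
  cases h3
  exact ⟨y, h1, h2⟩

theorem Wk_reach {k : ℕ} {x y : V} (h : Wk E k x y) : Reach E x y := by
  induction k generalizing x with
  | zero => cases h; exact .refl
  | succ k ih => obtain ⟨c, hc, h⟩ := h; exact .head hc (ih h)

theorem reach_Wk {x y : V} (h : Reach E x y) : ∃ k, Wk E k x y := by
  induction h with
  | refl => exact ⟨0, rfl⟩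
  | tail _ h2 ih => obtain ⟨k, hk⟩ := ih; exact ⟨k+1, Wk_snoc E hk h2⟩

theorem Wk_fun {k l : ℕ} {x : V} {q : ℕ → V} (h : Wk E k x (q 0))
    (hq : ∀ j < l, E (q j) (q (j+1))) :
    ∃ p : ℕ → V, p 0 = x ∧ (∀ j, p (k + j) = q j) ∧ ∀ j < k + l, E (p j) (p (j+1)) := by
  induction k generalizing x with
  | zero => exact ⟨q, h.symm, by simp, by simpa using hq⟩
  | succ k ih =>
    obtain ⟨c, hc, h⟩ := h
    obtain ⟨p, p0, p1, p2⟩ := ih h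
    refine ⟨fun j => Nat.casesOn j x p, rfl, ?_, ?_⟩
    · intro j
      rw [Nat.add_right_comm]; exact p1 j
    · intro j hj
      cases j with
      | zero => simpa [p0] using hc
      | succ j => exact p2 j (by omega)

theorem fun_Wk {p : ℕ → V} {n : ℕ} (hp : ∀ j < n, E (p j) (p (j+1))) (k i : ℕ) (h : i + k ≤ n) :
    Wk E k (p i) (p (i + k)) := by
  induction k with
  | zero => rfl
  | succ k ih => exact Wk_snoc E (ih (by omega)) (hp _ (by omega))

/-- The key closure property. -/
def Key (s e N : ℕ) : Prop :=
  ∀ a x y b z c : V, Wk E s a x → Wk E (e+1) x y → Wk E N y b → E x z → Wk E N z c → E y z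

theorem key_of_sep (t t' : BTree) (h : Sep E t t') (H : ∀ f : ℕ → V, Hm E t f → Hm E t' f) :
    ∃ s e N, Key E s e N := by
  obtain ⟨s, e, N, h⟩ := h
  refine ⟨s, e, N, fun a x y b z c h1 h2 h3 h4 h5 => ?_⟩
  obtain ⟨q, q0, -, q2⟩ := Wk_fun (l := 0) E (q := fun _ => c) h5 (by simp)
  obtain ⟨p1, p10, -, p12⟩ := Wk_fun (l := 0) E (q := fun _ => b) h3 (by simp)
  obtain ⟨p2, p20, p21, p22⟩ := Wk_fun E (p10.symm ▸ h2 : Wk E (e+1) x (p1 0)) p12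
  obtain ⟨p3, p30, p31, p32⟩ := Wk_fun E (p20.symm ▸ h1 : Wk E s a (p2 0)) p22
  have e1 : p3 s = x := by rw [← p20, ← p31 0]; rfl
  have e2 : p3 (s + 1 + e) = y := by
    rw [← p10, ← p21 0, ← p31]; congr 1; omega
  obtain ⟨f, -, hf, hf'⟩ := h p3 q (fun j hj => p32 j (by omega)) (fun j hj => q2 j (by omega))
    (by rw [e1, q0]; exact h4)
  have := hf' (H f hf)
  rwa [e2, q0] at this

theorem nontriv_iff {v : V} : InNontrivialSCC E v ↔ Relation.TransGen E v v := by
  unfold InNontrivialSCC Reach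
  rw [Relation.TransGen.head'_iff]

theorem fwd {x v : V} (hv : InNontrivialSCC E v) (h : Reach E x v) (k : ℕ) :
    ∃ b, Wk E k x b ∧ Reach E b v := by
  induction k generalizing x with
  | zero => exact ⟨x, rfl, h⟩
  | succ k ih =>
    have : Relation.TransGen E x v := Relation.TransGen.trans_right h ((nontriv_iff E).1 hv)
    obtain ⟨c, hc, hcv⟩ := Relation.TransGen.head'_iff.1 this
    obtain ⟨b, hb, hb'⟩ := ih hcv
    exact ⟨b, ⟨c, hc, hb⟩, hb'⟩

theorem bwd {x v : V} (hv : InNontrivialSCC E v) (h : Reach E v x) (k : ℕ) :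
    ∃ a, Wk E k a x := by
  induction k generalizing x with
  | zero => exact ⟨x, rfl⟩
  | succ k ih =>
    have : Relation.TransGen E v x := Relation.TransGen.trans_left ((nontriv_iff E).1 hv) h
    obtain ⟨c, hc, hcv⟩ := Relation.TransGen.tail'_iff.1 this
    obtain ⟨a, ha⟩ := ih hc
    exact ⟨a, Wk_snoc E ha hcv⟩

variable {E}

theorem key_use {s e N : ℕ} (K : Key E s e N) {u v w x y z : V} (hu : InNontrivialSCC E u)
    (hv : InNontrivialSCC E v) (hw : InNontrivialSCC E w)
    (hx : Reach E u x) (hxy : Wk E (e+1) x y) (hy : Reach E y v)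
    (hxz : E x z) (hz : Reach E z w) : E y z := by
  obtain ⟨a, ha⟩ := bwd E hu hx s
  obtain ⟨b, hb, -⟩ := fwd E hv hy N
  obtain ⟨c, hc, -⟩ := fwd E hw hz N
  exact K a x y b z c ha hxy hb hxz hc

theorem key_one {s e N : ℕ} (K : Key E s e N) {v x w z u : V} (hv : InNontrivialSCC E v)
    (hx : Reach E v x) (hw : E x w) (hz : E x z) (hwv : Reach E w v) (hzv : Reach E z v)
    (hu : E w u) (huv : Reach E u v) : E z u := by
  obtain ⟨y, hy, hyv⟩ := fwd E hv hwv e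
  have h1 : E y z := key_use K hv hv hv hx ⟨w, hw, hy⟩ hyv hz hzv
  exact key_use K hv hv hv (hx.tail hw) (Wk_snoc E hy h1) hzv hu huv

theorem key_k {s e N : ℕ} (K : Key E s e N) {v : V} (hv : InNontrivialSCC E v) (k : ℕ)
    {y z u : V} (hy : Wk E k v y) (hz : Wk E k v z) (hyv : Reach E y v) (hzv : Reach E z v)
    (hu : E y u) (huv : Reach E u v) : E z u := by
  induction k generalizing y z u with
  | zero => cases hy; cases hz; exact hu
  | succ k ih =>
    obtain ⟨y', hy', hyy⟩ := Wk_unsnoc E hy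
    obtain ⟨z', hz', hzz⟩ := Wk_unsnoc E hz
    have h1 : E z' y := ih hy' hz' (hyv.head hyy) (hzv.head hzz) hyy hyv
    exact key_one K hv (Wk_reach E hz') h1 hzz hyv hzv hu huv

theorem Wk_mul {m : ℕ} {v : V} (h : Wk E m v v) (A : ℕ) : Wk E (m * A) v v := by
  induction A with
  | zero => rfl
  | succ A ih => rw [Nat.mul_succ]; exact Wk_trans E ih h

theorem whirl_of_key {s e N : ℕ} (K : Key E s e N) {v : V} (hv : InNontrivialSCC E v) :
    ∃ m : ℕ, 1 ≤ m ∧ IsWhirlOn E (scc E v) m := by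
  classical
  have hex : ∃ m, 0 < m ∧ Wk E m v v := by
    obtain ⟨u, h1, h2⟩ := hv
    obtain ⟨k, hk⟩ := reach_Wk E h2
    exact ⟨k+1, by omega, u, h1, hk⟩
  obtain ⟨m, ⟨hm, hmv⟩, hmin⟩ : ∃ m, (0 < m ∧ Wk E m v v) ∧ ∀ n, 0 < n → Wk E n v v → m ≤ n :=
    ⟨Nat.find hex, Nat.find_spec hex, fun n h1 h2 => Nat.find_min' hex ⟨h1, h2⟩⟩
  have hdvd : ∀ n, Wk E n v v → m ∣ n := by
    intro n
    induction n using Nat.strong_induction_on with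
    | _ n ih =>
      intro hn
      rcases Nat.eq_zero_or_pos n with rfl | hpos
      · simp
      have hle := hmin n hpos hn
      obtain ⟨n', rfl⟩ := Nat.exists_eq_add_of_le hle
      obtain ⟨c, hc, hcv⟩ := Wk_split E hn
      cases n' with
      | zero => simp
      | succ n'' =>
        have hcr := Wk_reach E hcv
        obtain ⟨d, hd, hdv⟩ := hcv
        have := key_k K hv m hc hmv hcr .refl hd (Wk_reach E hdv)
        have := ih (n''+1) (by omega) ⟨d, this, hdv⟩
        exact dvd_add (dvd_refl m) this
  have : NeZero m := ⟨hm.ne'⟩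
  refine ⟨m, hm, fun i => {y | Reach E y v ∧ ∃ k : ℕ, (k : ZMod m) = i ∧ Wk E k v y}, ?_, ?_, ?_, ?_⟩
  · intro i
    obtain ⟨b, hb, hbv⟩ := fwd E hv .refl i.val
    exact ⟨b, hbv, i.val, by simp, hb⟩
  · rintro i y ⟨h1, k, -, h2⟩
    exact ⟨h1, Wk_reach E h2⟩
  · rintro y ⟨h1, h2⟩
    obtain ⟨k, hk⟩ := reach_Wk E h2
    refine ⟨k, ⟨h1, k, rfl, hk⟩, ?_⟩
    rintro j ⟨-, k', rfl, hk'⟩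
    obtain ⟨l, hl⟩ := reach_Wk E h1
    have a1 := (ZMod.natCast_eq_zero_iff _ m).2 (hdvd _ (Wk_trans E hk hl))
    have a2 := (ZMod.natCast_eq_zero_iff _ m).2 (hdvd _ (Wk_trans E hk' hl))
    push_cast at a1 a2
    exact add_right_cancel (a2.trans a1.symm)
  · rintro x ⟨hx1, hx2⟩ y ⟨hy1, hy2⟩
    constructor
    · intro hxy
      obtain ⟨k, hk⟩ := reach_Wk E hx2
      exact ⟨k, ⟨hx1, k, rfl, hk⟩, hy1, k+1, by push_cast; rfl, Wk_snoc E hk hxy⟩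
    · rintro ⟨i, ⟨-, k, rfl, hk⟩, -, k', hk', hy⟩
      have hmod : k' ≡ k + 1 [MOD m] := (ZMod.natCast_eq_natCast_iff _ _ _).1 (by push_cast; exact hk')
      obtain ⟨A, B, hAB⟩ : ∃ A B, m * A + (k + 1) = m * B + k' := by
        rcases le_total k' (k+1) with h | h
        · obtain ⟨B, hB⟩ := (Nat.modEq_iff_dvd' h).1 hmod
          exact ⟨0, B, by omega⟩
        · obtain ⟨B, hB⟩ := (Nat.modEq_iff_dvd' h).1 hmod.symm
          exact ⟨B, 0, by omega⟩
      have w1 := Wk_trans E (Wk_mul hmv A) hk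
      have w2 := Wk_trans E (Wk_mul hmv B) hy
      rw [← hAB, ← add_assoc] at w2
      obtain ⟨y', hy', hyy⟩ := Wk_unsnoc E w2
      exact key_k K hv _ hy' w1 (hy1.head hyy) hx1 hyy hy1

theorem cross_of_key {s e N : ℕ} (K : Key E s e N) {u v : V} (hu : InNontrivialSCC E u)
    (hv : InNontrivialSCC E v) (h : Reach E u v) : Reach E v u := by
  by_contra hvu
  have : ∀ c, Reach E c v → Reach E u c → Reach E c u →
      ∃ x w, Reach E u x ∧ Reach E x u ∧ E x w ∧ Reach E w v ∧ ¬ Reach E w u := by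
    intro c hc
    induction hc using Relation.ReflTransGen.head_induction_on with
    | refl => intro _ h; exact absurd h hvu
    | head h1 h2 ih =>
      rename_i a b
      intro h3 h4
      by_cases hb : Reach E b u
      · exact ih (h3.tail h1) hb
      · exact ⟨a, b, h3, h4, h1, h2, hb⟩
  obtain ⟨x, w, h1, h2, h3, h4, h5⟩ := this u h .refl .refl
  have : Relation.TransGen E x u := Relation.TransGen.trans_right h2 ((nontriv_iff E).1 hu)
  obtain ⟨z, hz, hzu⟩ := Relation.TransGen.head'_iff.1 this
  obtain ⟨y, hy, hyv⟩ := fwd E hv h4 e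
  have := key_use K hu hv hu h1 ⟨w, h3, hy⟩ hyv hz hzu
  exact h5 ((Wk_reach E hy).trans (hzu.head this))

theorem path_of_key {s e N : ℕ} (K : Key E s e N) (len : ℕ) (p : ℕ → V)
    (hp : IsPath E len p) (hpl : IsPleasant E len p) : len ≤ s + 1 + e + N := by
  by_contra hlt
  push Not at hlt
  have w := fun_Wk E hp.1
  have : E (p (s + (e + 1))) (p (s+1)) :=
    K (p 0) (p s) _ _ _ _ (by simpa using w s 0 (by omega)) (w (e+1) s (by omega))
      (w N _ (by omega)) (hp.1 s (by omega)) (w N _ (by omega))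
  refine hpl (s+1) (by omega) ((nontriv_iff E).2 ?_)
  have h2 := Wk_reach E (w e (s+1) (by omega))
  rw [show s + 1 + e = s + (e + 1) by omega] at h2
  exact Relation.TransGen.tail' h2 this

theorem bound_of_key {s e N : ℕ} (K : Key E s e N) (m : ℕ) (v : V) (hm : 1 ≤ m)
    (h : IsWhirlOn E (scc E v) m) : m ≤ e + 1 := by
  have : NeZero m := ⟨by omega⟩
  obtain ⟨B, hB1, hB2, hB3, hB4⟩ := h
  choose g hg using hB1
  have hgs : ∀ i, g i ∈ scc E v := fun i => hB2 i (hg i)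
  have hE : ∀ i, E (g i) (g (i+1)) := fun i => (hB4 _ (hgs _) _ (hgs _)).2 ⟨i, hg _, hg _⟩
  have hW : ∀ k : ℕ, Wk E k (g 0) (g k) := by
    intro k
    induction k with
    | zero => simp [Wk]
    | succ k ih => push_cast; exact Wk_snoc E ih (hE _)
  have hr : ∀ i j, Reach E (g i) (g j) := fun i j => (hgs i).1.trans (hgs j).2
  have hT : InNontrivialSCC E (g 0) := ⟨_, hE 0, hr _ _⟩
  have := key_use K hT hT hT .refl (hW (e+1)) (hr _ _) (hE 0) (hr _ _)
  obtain ⟨i, h1, h2⟩ := (hB4 _ (hgs _) _ (hgs _)).1 this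
  have e1 := (hB3 _ (hgs _)).unique h1 (hg _)
  have e2 := (hB3 _ (hgs _)).unique h2 (hg _)
  have : ((e+1 : ℕ) : ZMod m) = 0 := by
    rw [← e1]; simpa using e2
  exact Nat.le_of_dvd (by omega) ((ZMod.natCast_eq_zero_iff _ _).1 this)

/-- Path bracketing followed by `X`. -/
def Up : ℕ → BTree → BTree
  | 0, X => X
  | s+1, X => .node .leaf (Up s X)

theorem Up_size (s : ℕ) (X : BTree) : (Up s X).size = s + X.size := by
  induction s with
  | zero => simp [Up]
  | succ s ih => simp [Up, BTree.size, ih]; omega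

theorem Up_add (s k : ℕ) (X : BTree) : Up (s + k) X = Up s (Up k X) := by
  induction s with
  | zero => simp [Up]
  | succ s ih => rw [Nat.add_right_comm]; simp [Up, ih]

theorem Up_inj (s : ℕ) (X Y : BTree) (h : Up s X = Up s Y) : X = Y := by
  induction s with
  | zero => exact h
  | succ s ih => simp only [Up, BTree.node.injEq, true_and] at h; exact ih h

theorem Hm_Up (s : ℕ) (X : BTree) (f : ℕ → V) :
    Hm E (Up s X) f ↔ (∀ j < s, E (f j) (f (j+1))) ∧ Hm E X (fun j => f (j + s)) := by
  induction s generalizing f with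
  | zero => simp [Up]
  | succ s ih =>
    simp only [Up, Hm, BTree.size, ih, true_and]
    have : (fun j => f (j + s + 1)) = fun j => f (j + (s + 1)) := rfl
    rw [this]
    constructor
    · rintro ⟨⟨h1, h2⟩, h3⟩
      refine ⟨fun j hj => ?_, h2⟩
      cases j with
      | zero => exact h3
      | succ j => exact h1 j (by omega)
    · rintro ⟨h1, h2⟩
      exact ⟨⟨fun j hj => h1 (j+1) (by omega), h2⟩, h1 0 (by omega)⟩

theorem walk_nontriv {N : ℕ} (hN : ∀ (len : ℕ) (p : ℕ → V),
        IsPath E len p → IsPleasant E len p → len ≤ N) (p : ℕ → V)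
    (hp : ∀ j < N + 1, E (p j) (p (j+1))) : ∃ j ≤ N + 1, InNontrivialSCC E (p j) := by
  by_contra hcon
  push Not at hcon
  have key : ∀ i j, i < j → j ≤ N + 1 → p i ≠ p j := by
    intro i j hij hj heq
    refine hcon i (by omega) ⟨p (i+1), hp i (by omega), ?_⟩
    have := Wk_reach E (fun_Wk E hp (j - (i+1)) (i+1) (by omega))
    rwa [show i + 1 + (j - (i+1)) = j by omega, ← heq] at this
  have := hN (N+1) p ⟨hp, fun i hi j hj h => by
    rcases lt_trichotomy i j with h' | h' | h'
    · exact absurd h (key _ _ h' hj)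
    · exact h'
    · exact absurd h.symm (key _ _ h' hi)⟩ hcon
  omega

theorem attach_iff {N M : ℕ}
    (h1 : ∀ v : V, InNontrivialSCC E v → ∃ m : ℕ, 1 ≤ m ∧ IsWhirlOn E (scc E v) m)
    (h2 : ∀ u v : V, InNontrivialSCC E u → InNontrivialSCC E v → Reach E u v → Reach E v u)
    (h3 : ∀ (len : ℕ) (p : ℕ → V), IsPath E len p → IsPleasant E len p → len ≤ N)
    (h4 : ∀ (m : ℕ) (v : V), 1 ≤ m → IsWhirlOn E (scc E v) m → m ≤ M)
    (p q : ℕ → V) (hp : ∀ j < (N+1) + (M.factorial + (N+1)), E (p j) (p (j+1)))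
    (hq : ∀ j < N+1, E (q j) (q (j+1))) :
    E (p (N+1)) (q 0) ↔ E (p (N + 1 + M.factorial)) (q 0) := by
  set P := M.factorial with hP
  have hr : ∀ i j, i ≤ j → j ≤ (N+1) + (P + (N+1)) → Reach E (p i) (p j) := by
    intro i j hij hj
    have := Wk_reach E (fun_Wk E hp (j - i) i (by omega))
    rwa [show i + (j - i) = j by omega] at this
  obtain ⟨a, ha, hat⟩ := walk_nontriv h3 p (fun j hj => hp j (by omega))
  obtain ⟨b, hb, hbt⟩ := walk_nontriv h3 (fun j => p (N + 1 + P + j)) (fun j hj => hp _ (by omega))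
  obtain ⟨c, hc, hct⟩ := walk_nontriv h3 q hq
  have hba := h2 _ _ hat hbt (hr _ _ (by omega) (by omega))
  have hqc : Reach E (q 0) (q c) := by
    simpa using Wk_reach E (fun_Wk E hq c 0 (by omega))
  obtain ⟨m, hm, hw⟩ := h1 _ hat
  have hmP : m ∣ P := Nat.dvd_factorial (by omega) (h4 m _ hm hw)
  obtain ⟨B, hB1, hB2, hB3, hB4⟩ := hw
  have hsp : ∀ j, N + 1 ≤ j → j ≤ N + 1 + P → p j ∈ scc E (p a) := fun j hj hj' =>
    ⟨(hr j (N+1+P+b) (by omega) (by omega)).trans hba, hr a j (by omega) (by omega)⟩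
  have hsq : ∀ j, N + 1 ≤ j → j ≤ N + 1 + P → E (p j) (q 0) → q 0 ∈ scc E (p a) := by
    intro j hj hj' h
    have h5 : Reach E (p a) (q 0) := (hsp j hj hj').2.tail h
    exact ⟨hqc.trans (h2 _ _ hat hct (h5.trans hqc)), h5⟩
  obtain ⟨i, hi, -⟩ := hB3 _ (hsp (N+1) (by omega) (by omega))
  have hblk : ∀ k ≤ P, p (N+1+k) ∈ B (i + k) := by
    intro k
    induction k with
    | zero => intro _; simpa using hi
    | succ k ih =>
      intro hk
      obtain ⟨i', h5, h6⟩ := (hB4 _ (hsp (N+1+k) (by omega) (by omega)) _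
        (hsp (N+1+(k+1)) (by omega) (by omega))).1 (hp (N+1+k) (by omega))
      have := (hB3 _ (hsp (N+1+k) (by omega) (by omega))).unique h5 (ih (by omega))
      rw [this] at h6
      push_cast; rw [← add_assoc]; exact h6
  have hiP : p (N+1+P) ∈ B i := by
    have := hblk P le_rfl
    rwa [(ZMod.natCast_eq_zero_iff _ _).2 hmP, add_zero] at this
  have hs0 := hsp (N+1) (by omega) (by omega)
  have hs1 := hsp (N+1+P) (by omega) (by omega)
  constructor
  · intro h
    have hs := hsq _ (by omega) (by omega) h
    obtain ⟨i', h5, h6⟩ := (hB4 _ hs0 _ hs).1 h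
    rw [(hB3 _ hs0).unique h5 hi] at h6
    exact (hB4 _ hs1 _ hs).2 ⟨i, hiP, h6⟩
  · intro h
    have hs := hsq _ (by omega) (by omega) h
    obtain ⟨i', h5, h6⟩ := (hB4 _ hs1 _ hs).1 h
    rw [(hB3 _ hs1).unique h5 hiP] at h6
    exact (hB4 _ hs0 _ hs).2 ⟨i, hi, h6⟩

theorem exists_identity [Nonempty V] {N M : ℕ}
    (h1 : ∀ v : V, InNontrivialSCC E v → ∃ m : ℕ, 1 ≤ m ∧ IsWhirlOn E (scc E v) m)
    (h2 : ∀ u v : V, InNontrivialSCC E u → InNontrivialSCC E v → Reach E u v → Reach E v u)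
    (h3 : ∀ (len : ℕ) (p : ℕ → V), IsPath E len p → IsPleasant E len p → len ≤ N)
    (h4 : ∀ (m : ℕ) (v : V), 1 ≤ m → IsWhirlOn E (scc E v) m → m ≤ M) :
    ∃ t t' : BTree, t.size = t'.size ∧ t ≠ t' ∧ Satisfies (gaOp E) t t' := by
  have key := attach_iff h1 h2 h3 h4
  have hPpos := M.factorial_pos
  generalize M.factorial = P at key hPpos
  have hs : (Up (N+1) (.node (Up (P + (N+1)) .leaf) (Up (N+1) .leaf))).size =
    (Up (N+1+P) (.node (Up (N+1) .leaf) (Up (N+1) .leaf))).size := by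
    simp only [Up_size, BTree.size]; omega
  refine ⟨_, _, hs, ?_, ?_⟩
  · rw [Up_add (N+1) P]
    intro h
    have := Up_inj _ _ _ h
    obtain ⟨P', rfl⟩ := Nat.exists_eq_add_of_le' hPpos
    rw [show P' + 1 + (N + 1) = (P' + (N+1)) + 1 by omega] at this
    simp [Up] at this
  · rw [satisfies_iff E _ _ hs]
    intro f
    simp only [Hm_Up, Hm, Up_size, BTree.size, and_true]
    have key' := key f (fun j => f (j + (P + (N+1) + 1) + (N+1)))
    have e0 : (fun j => f (j + (N + 1 + 1) + (N + 1 + P))) =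
        (fun j => f (j + (P + (N+1) + 1) + (N+1))) := by
      funext j; congr 1; omega
    have e1 : ∀ j, f (j + (N + 1 + 1) + (N + 1 + P)) = f (j + (P + (N+1) + 1) + (N+1)) :=
      fun j => congrFun e0 j
    have e2 := e1 0
    simp only [zero_add] at e2
    simp only [e1, e2, zero_add] at key' ⊢
    constructor
    · rintro ⟨a1, a2, a3, a4⟩
      have hw : ∀ j < (N+1) + (P + (N+1)), E (f j) (f (j+1)) := by
        intro j hj
        by_cases hj' : j < N + 1
        · exact a1 j hj'
        · have := a2 (j - (N+1)) (by omega)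
          convert this using 2 <;> omega
      refine ⟨fun j hj => hw j (by omega), fun j hj => ?_, a3, (key' hw a3).1 a4⟩
      convert hw (j + (N+1+P)) (by omega) using 2; omega
    · rintro ⟨a1, a2, a3, a4⟩
      have hw : ∀ j < (N+1) + (P + (N+1)), E (f j) (f (j+1)) := by
        intro j hj
        by_cases hj' : j < N + 1 + P
        · exact a1 j hj'
        · have := a2 (j - (N+1+P)) (by omega)
          convert this using 2 <;> omega
      refine ⟨fun j hj => hw j (by omega), fun j hj => ?_, a3, (key' hw a3).2 a4⟩
      convert hw (j + (N+1)) (by omega) using 2; omega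

end Helpers

end AssocSpec

open AssocSpec in
/-- A digraph `G` is not antiassociative (its graph algebra
satisfies some nontrivial bracketing identity) iff: (i) every nontrivial
strongly connected component of `G` is a whirl; (ii) there is no path from one
nontrivial strongly connected component to another; (iii) the lengths of the
pleasant paths in `G` are bounded; (iv) the numbers `m` such that some
strongly connected component of `G` is an `m`-whirl are bounded. -/
theorem stmt3 {V : Type*} [Nonempty V] (E : V → V → Prop) :
    (∃ t t' : BTree, t.size = t'.size ∧ t ≠ t' ∧ Satisfies (gaOp E) t t') ↔
    ((∀ v : V, InNontrivialSCC E v → ∃ m : ℕ, 1 ≤ m ∧ IsWhirlOn E (scc E v) m) ∧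
     (∀ u v : V, InNontrivialSCC E u → InNontrivialSCC E v →
        Reach E u v → Reach E v u) ∧
     (∃ N : ℕ, ∀ (len : ℕ) (p : ℕ → V),
        IsPath E len p → IsPleasant E len p → len ≤ N) ∧
     (∃ N : ℕ, ∀ (m : ℕ) (v : V), 1 ≤ m → IsWhirlOn E (scc E v) m → m ≤ N)) := by
  constructor
  · rintro ⟨t, t', hs, hne, hsat⟩
    have H := (satisfies_iff E t t' hs).1 hsat
    obtain ⟨s, e, N, K⟩ : ∃ s e N, Key E s e N := by
      rcases Sep_total E t t' hs hne with h | h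
      · exact key_of_sep E t t' h fun f => (H f).1
      · exact key_of_sep E t' t h fun f => (H f).2
    exact ⟨fun v hv => whirl_of_key K hv, fun u v hu hv h => cross_of_key K hu hv h,
      ⟨_, fun len p h1 h2 => path_of_key K len p h1 h2⟩,
      ⟨_, fun m v h1 h2 => bound_of_key K m v h1 h2⟩⟩
  · rintro ⟨h1, h2, ⟨N, h3⟩, ⟨M, h4⟩⟩
    exact exists_identity h1 h2 h3 h4
end

section
/- A sequence (d_1, …, d_n) of nonnegative integers is the depth sequence of some DFS tree of size n (i.e., there is a DFS tree T of size n with d_T(x_i) = d_i for all i) if and only if it is a zag sequence, i.e., d_1 = 0, d_2 = 1, and 1 ≤ d_{i+1} ≤ d_i + 1 for all 1 ≤ i ≤ n−1. -/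
namespace AssocSpec

theorem zag_exists_zero {n : ℕ} (T : DFSTree n) (i : Fin n) :
    ∃ k : ℕ, (T.parent^[k] i : ℕ) = 0 := by
  obtain ⟨m, hm⟩ : ∃ m : ℕ, (i : ℕ) = m := ⟨_, rfl⟩
  induction m using Nat.strong_induction_on generalizing i with
  | _ m ih =>
    rcases Nat.eq_zero_or_pos (i : ℕ) with h | h
    · exact ⟨0, h⟩
    · obtain ⟨k, hk⟩ := ih _ (by have := T.parent_lt i h; omega) (T.parent i) rfl
      exact ⟨k + 1, by rw [Function.iterate_succ_apply]; exact hk⟩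

theorem zag_depth_zero {n : ℕ} (T : DFSTree n) (i : Fin n) (h : (i : ℕ) = 0) :
    T.depth i = 0 := by
  unfold DFSTree.depth
  exact Nat.sInf_eq_zero.2 (Or.inl h)

theorem zag_depth_succ {n : ℕ} (T : DFSTree n) (i : Fin n) (h : 0 < (i : ℕ)) :
    T.depth i = T.depth (T.parent i) + 1 := by
  have h1 : (T.parent^[T.depth i] i : ℕ) = 0 := Nat.sInf_mem (zag_exists_zero T i)
  have h2 : (T.parent^[T.depth (T.parent i)] (T.parent i) : ℕ) = 0 :=
    Nat.sInf_mem (zag_exists_zero T (T.parent i))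
  apply le_antisymm
  · apply Nat.sInf_le
    change (T.parent^[_] i : ℕ) = 0
    rw [Function.iterate_succ_apply]; exact h2
  · cases hd : T.depth i with
    | zero => rw [hd] at h1; simp at h1; omega
    | succ k =>
      rw [hd, Function.iterate_succ_apply] at h1
      have : T.depth (T.parent i) ≤ k := Nat.sInf_le h1
      omega

theorem zag_depth_iter {n : ℕ} (T : DFSTree n) (a : ℕ) (i : Fin n) :
    T.depth (T.parent^[a] i) ≤ T.depth i := by
  induction a generalizing i with
  | zero => exact le_rfl
  | succ a ih =>
    rw [Function.iterate_succ_apply]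
    refine (ih _).trans ?_
    rcases Nat.eq_zero_or_pos (i : ℕ) with h | h
    · rw [T.parent_root i h]
    · rw [zag_depth_succ T i h]; omega

theorem zag_parent_exists {n : ℕ} (d : Fin n → ℕ) (hd : IsZag d) (i : Fin n) :
    ∃ p : Fin n, ((i : ℕ) = 0 → p = i) ∧
      (0 < (i : ℕ) → p < i ∧ d i = d p + 1 ∧ ∀ j, p < j → j ≤ i → d i ≤ d j) := by
  obtain ⟨h0, -, hs⟩ := hd
  rcases Nat.eq_zero_or_pos (i : ℕ) with h | h
  · exact ⟨i, fun _ => rfl, fun h' => by omega⟩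
  · have hn : 0 < n := by have := i.2; omega
    have hi : 1 ≤ d i := by
      have := (hs (i - 1) (by have := i.2; omega)).1
      have e : (⟨(i : ℕ) - 1 + 1, by have := i.2; omega⟩ : Fin n) = i := by
        ext; simp; omega
      rwa [e] at this
    have hne : (Finset.univ.filter fun j : Fin n => j < i ∧ d j < d i).Nonempty :=
      ⟨⟨0, hn⟩, Finset.mem_filter.2 ⟨Finset.mem_univ _, Fin.lt_def.2 h, by rw [h0 hn]; omega⟩⟩
    obtain ⟨p, hp, hmax⟩ := Finset.exists_max_image _ id hne
    simp only [Finset.mem_filter, Finset.mem_univ, true_and, id] at hp hmax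
    have key : ∀ j, p < j → j ≤ i → d i ≤ d j := by
      intro j hj hji
      by_contra hc
      push Not at hc
      rcases hji.lt_or_eq with h1 | h1
      · exact absurd (hmax j ⟨h1, hc⟩) (not_le.2 hj)
      · rw [h1] at hc; omega
    refine ⟨p, fun h' => by omega, fun _ => ⟨hp.1, ?_, key⟩⟩
    have hpi : (p : ℕ) < i := hp.1
    have hlt : (p : ℕ) + 1 < n := by have := i.2; omega
    have h1 := (hs p hlt).2
    have h2 := key ⟨p + 1, hlt⟩ (by simp [Fin.lt_def]) (by simp [Fin.le_def]; omega)
    have h3 := hp.2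
    simp only [Fin.eta] at h1
    omega

end AssocSpec

open AssocSpec in
/-- A sequence `(d₁, …, d_n)` of nonnegative integers is the
depth sequence of some DFS tree of size `n` iff it is a zag sequence. -/
theorem stmt18 (n : ℕ) (d : Fin n → ℕ) :
    (∃ T : DFSTree n, ∀ i : Fin n, T.depth i = d i) ↔ IsZag d := by
  constructor
  · rintro ⟨T, hT⟩
    refine ⟨fun h => ?_, fun h => ?_, fun i h => ?_⟩
    · rw [← hT]; exact zag_depth_zero T _ rfl
    · rw [← hT, zag_depth_succ T _ (by simp), zag_depth_zero T]
      have := T.parent_lt ⟨1, h⟩ (by simp)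
      simp at this
      exact this
    · rw [← hT, ← hT, zag_depth_succ T _ (by simp)]
      refine ⟨by omega, ?_⟩
      have hp := T.parent_lt ⟨i + 1, h⟩ (by simp)
      simp only at hp
      obtain ⟨a, ha⟩ := T.interval (T.parent ⟨i + 1, h⟩) ⟨i, by omega⟩ ⟨i + 1, h⟩
        (by rw [Fin.le_def]; simp only; omega) (by simp [Fin.le_def]) ⟨1, rfl⟩
      have := zag_depth_iter T a ⟨i, by omega⟩
      rw [ha] at this
      omega
  · intro hd
    choose p hp0 hp using zag_parent_exists d hd
    have anc : ∀ (a : ℕ) (i k : Fin n), p^[a] k = i →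
        i ≤ k ∧ ∀ j, i < j → j ≤ k → d i < d j := by
      intro a
      induction a with
      | zero =>
        intro i k h
        simp at h
        subst h
        exact ⟨le_rfl, fun j h1 h2 => absurd h1 (not_lt.2 h2)⟩
      | succ a ih =>
        intro i k h
        rw [Function.iterate_succ_apply] at h
        obtain ⟨h1, h2⟩ := ih i (p k) h
        rcases Nat.eq_zero_or_pos (k : ℕ) with hk | hk
        · rw [hp0 k hk] at h1 h2
          exact ⟨h1, h2⟩
        · obtain ⟨q1, q2, q3⟩ := hp k hk
          refine ⟨h1.trans q1.le, fun j hj hjk => ?_⟩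
          rcases le_or_gt j (p k) with hc | hc
          · exact h2 j hj hc
          · have := q3 j hc hjk
            have : d i ≤ d (p k) := by
              rcases h1.lt_or_eq with h' | h'
              · exact (h2 _ h' le_rfl).le
              · rw [h']
            omega
    have conv : ∀ (m : ℕ) (i k : Fin n), (k : ℕ) = m → i ≤ k →
        (∀ j, i < j → j ≤ k → d i < d j) → ∃ a : ℕ, p^[a] k = i := by
      intro m
      induction m using Nat.strong_induction_on with
      | _ m ih =>
        intro i k hk hik h
        rcases hik.lt_or_eq with h1 | h1
        · have h1' : (i : ℕ) < k := h1
          obtain ⟨q1, q2, q3⟩ := hp k (by omega)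
          have hle : i ≤ p k := by
            by_contra hc
            have := q3 i (not_le.1 hc) hik
            have := h k h1 le_rfl
            omega
          obtain ⟨a, ha⟩ := ih (p k) (by rw [← hk]; exact q1) i (p k) rfl hle
            (fun j hj hjk => h j hj (hjk.trans q1.le))
          exact ⟨a + 1, by rw [Function.iterate_succ_apply]; exact ha⟩
        · exact ⟨0, h1.symm⟩
    let T : DFSTree n :=
      { parent := p
        parent_lt := fun i hi => (hp i hi).1
        parent_root := hp0
        interval := by
          rintro i j k hij hjk ⟨a, ha⟩
          exact conv _ i j rfl hij
            (fun l h1 h2 => (anc a i k ha).2 l h1 (h2.trans hjk)) }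
    refine ⟨T, fun i => ?_⟩
    obtain ⟨m, hm⟩ : ∃ m : ℕ, (i : ℕ) = m := ⟨_, rfl⟩
    induction m using Nat.strong_induction_on generalizing i with
    | _ m ih =>
      rcases Nat.eq_zero_or_pos (i : ℕ) with h | h
      · rw [zag_depth_zero T i h]
        have hn : 0 < n := by have := i.2; omega
        have e : i = ⟨0, hn⟩ := Fin.ext h
        rw [e, hd.1 hn]
      · have q := hp i h
        rw [zag_depth_succ T i h, q.2.1]
        have : T.depth (p i) = d (p i) := ih (p i) (by rw [← hm]; exact q.1) (p i) rfl
        change T.depth (p i) + 1 = _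
        rw [this]
end
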